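/- arXiv:1211.1477 — 2 statements merged into one kernel-verified Lean document; each statement's English description precedes it below -/
import Mathlib

section
/- Let (R,m) be a Noetherian local ring, M, N finitely generated R-modules, k ≥ -1 an integer, and r = depth_k(ann(M), N) < ∞. Let x_1,...,x_r be an N-sequence in dimension > k contained in √(ann(M)). Then for every integer l ≤ r: ⋃_{j≤l} {p ∈ Ass_R(Ext^j_R(M,N)) : dim(R/p) ≥ k} = ⋃_{j≤l} {p ∈ Ass_R(N/(x_1,...,x_j)N) : dim(R/p) ≥ k and ann(M) ⊆ p}. -/
open CategoryTheory Opposite IsLocalRing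

/-- Interpretation of an integer `k ≥ -1` in `WithBot ℕ∞`, for comparison with Krull dimensions. -/
noncomputable def zdim (k : ℤ) : WithBot (WithTop ℕ) :=
  if k < 0 then ⊥ else ((k.toNat : WithTop ℕ) : WithBot (WithTop ℕ))

/-- The ideal generated by the first `j` entries of the sequence `x`. -/
def prefIdeal {R : Type} [CommRing R] {r : ℕ} (x : Fin r → R) (j : ℕ) : Ideal R :=
  Ideal.span (x '' {i | (i : ℕ) < j})

/-- `x` is an `N`-sequence in dimension `> k`: for each `i`, `x i` avoids every associated
prime `p` of `N/(x_0,…,x_{i-1})N` with `dim(R/p) > k`. -/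
def IsSeqInDimGT (R : Type) [CommRing R] (N : Type) [AddCommGroup N] [Module R N]
    (k : ℤ) {r : ℕ} (x : Fin r → R) : Prop :=
  ∀ i : Fin r, ∀ p ∈ associatedPrimes R (N ⧸ (prefIdeal x (i : ℕ) • ⊤ : Submodule R N)),
    zdim k < ringKrullDim (R ⧸ p) → x i ∉ p

/-- `depth_k(I,N)`: the common length of maximal `N`-sequences in dimension `> k`
contained in `I` (realized as the supremum of lengths of such sequences). -/
noncomputable def depthK (R : Type) [CommRing R] (k : ℤ) (I : Ideal R)
    (N : Type) [AddCommGroup N] [Module R N] : ℕ∞ :=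
  sSup {n : ℕ∞ | ∃ (r : ℕ) (x : Fin r → R),
    (∀ i, x i ∈ I) ∧ IsSeqInDimGT R N k x ∧ n = (r : ℕ∞)}

/-- The set of prime (or arbitrary) ideals `p` with `dim(R/p) ≥ k`. -/
def dimGE (R : Type) [CommRing R] (k : ℤ) : Set (Ideal R) :=
  {p | zdim k ≤ ringKrullDim (R ⧸ p)}

section Complex

variable {R : Type} [CommRing R] {P : ℕ → Type} [∀ n, AddCommGroup (P n)] [∀ n, Module R (P n)]
  (d : ∀ n, P (n + 1) →ₗ[R] P n)

/-- The coboundaries in degree `n` of the complex `Hom(P, N)`. -/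
def coboundaries (N : Type) [AddCommGroup N] [Module R N] :
    ∀ n, Submodule R (P n →ₗ[R] N)
  | 0 => ⊥
  | n + 1 => LinearMap.range (LinearMap.lcomp R N (d n))

/-- The `n`-th cohomology of `Hom(P, N)` has an element whose annihilator becomes `p` after
localizing at `p`. -/
def IsLocallyAssociated (p : Ideal R) (n : ℕ) (N : Type) [AddCommGroup N] [Module R N] : Prop :=
  ∃ f : P n →ₗ[R] N, f ∘ₗ d n = 0 ∧
    ∀ a, (∃ t ∉ p, (t * a) • f ∈ coboundaries d N n) ↔ a ∈ p

/-- The `n`-th cohomology of `Hom(P, N)` vanishes after localizing at `p`. -/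
def IsLocallyZero (p : Ideal R) (n : ℕ) (N : Type) [AddCommGroup N] [Module R N] : Prop :=
  ∀ f : P n →ₗ[R] N, f ∘ₗ d n = 0 → ∃ t ∉ p, t • f ∈ coboundaries d N n

variable {d} {N N' : Type} [AddCommGroup N] [Module R N] [AddCommGroup N'] [Module R N']

lemma comp_eq_zero_of_mem_coboundaries (hd : ∀ n, d n ∘ₗ d (n + 1) = 0) {n : ℕ}
    {v : P n →ₗ[R] N} (hv : v ∈ coboundaries d N n) : v ∘ₗ d n = 0 := by
  cases n with
  | zero =>
    rw [show v = 0 from hv, LinearMap.zero_comp]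
  | succ n =>
    obtain ⟨u, rfl⟩ := hv
    rw [LinearMap.lcomp_apply', LinearMap.comp_assoc, hd, LinearMap.comp_zero]

lemma comp_mem_coboundaries (q : N →ₗ[R] N') {n : ℕ} {v : P n →ₗ[R] N}
    (hv : v ∈ coboundaries d N n) : q ∘ₗ v ∈ coboundaries d N' n := by
  cases n with
  | zero =>
    rw [show v = 0 from hv, LinearMap.comp_zero]
    exact zero_mem _
  | succ n =>
    obtain ⟨u, rfl⟩ := hv
    exact ⟨q ∘ₗ u, rfl⟩

/-- If the `n`-th cohomology of `Hom(P, N)` vanishes locally, then so does the kernel of the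
connecting homomorphism. -/
lemma exists_smul_comp_mem_coboundaries {p : Ideal R} {q : N →ₗ[R] N'} {x : R}
    (hqx : ∀ y, q y = 0 ↔ ∃ z, y = x • z) {n : ℕ}
    (hz : IsLocallyZero d p n N) {g : P n →ₗ[R] N} {f : P (n + 1) →ₗ[R] N}
    (hgf : g ∘ₗ d n = x • f) {a : R} (ha : a • f ∈ coboundaries d N (n + 1)) :
    ∃ t ∉ p, (t * a) • (q ∘ₗ g) ∈ coboundaries d N' n := by
  obtain ⟨u, hu⟩ := ha
  obtain ⟨t, ht, h⟩ := hz (a • g - x • u) (by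
    rw [LinearMap.sub_comp, LinearMap.smul_comp, LinearMap.smul_comp, hgf,
      show u ∘ₗ d n = a • f from hu, smul_comm, sub_self])
  refine ⟨t, ht, ?_⟩
  convert comp_mem_coboundaries q h using 1
  ext y
  have : q (x • u y) = 0 := (hqx _).2 ⟨_, rfl⟩
  simp only [map_smul] at this
  simp [mul_smul, this]

variable [∀ n, Module.Projective R (P n)]

lemma exists_mem_coboundaries_comp_eq {q : N →ₗ[R] N'} (hq : Function.Surjective q) {n : ℕ}
    {u : P n →ₗ[R] N'} (hu : u ∈ coboundaries d N' n) :
    ∃ v ∈ coboundaries d N n, q ∘ₗ v = u := by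
  cases n with
  | zero => exact ⟨0, zero_mem _, by rw [show u = 0 from hu, LinearMap.comp_zero]⟩
  | succ n =>
    obtain ⟨u, rfl⟩ := hu
    obtain ⟨v, rfl⟩ := Module.projective_lifting_property q u hq
    exact ⟨_, ⟨v, rfl⟩, rfl⟩

lemma exists_smul_eq_of_comp_eq_zero {q : N →ₗ[R] N'} {x : R}
    (hqx : ∀ y, q y = 0 → ∃ z, y = x • z) {L : Type} [AddCommGroup L] [Module R L]
    [Module.Projective R L] {u : L →ₗ[R] N} (hu : q ∘ₗ u = 0) : ∃ w : L →ₗ[R] N, u = x • w := by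
  obtain ⟨w, hw⟩ := Module.projective_lifting_property (LinearMap.lsmul R N x).rangeRestrict
    (u.codRestrict (LinearMap.range (LinearMap.lsmul R N x)) fun y ↦ by
      obtain ⟨z, hz⟩ := hqx (u y) (LinearMap.congr_fun hu y)
      exact ⟨z, hz.symm⟩) (LinearMap.surjective_rangeRestrict _)
  refine ⟨w, LinearMap.ext fun y ↦ ?_⟩
  exact (congrArg Subtype.val (LinearMap.congr_fun hw y)).symm

section Connecting

variable {q : N →ₗ[R] N'} {x s : R} {p : Ideal R} [p.IsPrime]

/-- The connecting homomorphism of `x : N → N` is well defined and injective up to `s`, which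
kills the kernel of `x`. -/
lemma smul_mem_coboundaries_of_comp_eq_smul (hd : ∀ n, d n ∘ₗ d (n + 1) = 0)
    (hq : Function.Surjective q) (hqx : ∀ y, q y = 0 → ∃ z, y = x • z)
    (hs : ∀ y : N, x • y = 0 → s • y = 0) {n : ℕ}
    {g : P n →ₗ[R] N} {f : P (n + 1) →ₗ[R] N} (hgf : g ∘ₗ d n = x • f) {a : R}
    (ha : a • (q ∘ₗ g) ∈ coboundaries d N' n) : (s * a) • f ∈ coboundaries d N (n + 1) := by
  obtain ⟨v, hv, hvg⟩ := exists_mem_coboundaries_comp_eq hq ha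
  obtain ⟨w, hw⟩ := exists_smul_eq_of_comp_eq_zero (u := a • g - v) hqx (by
    rw [LinearMap.comp_sub, hvg, LinearMap.comp_smul, sub_self])
  refine ⟨s • w, LinearMap.ext fun y ↦ ?_⟩
  have h₁ := LinearMap.congr_fun hw (d n y)
  have h₂ := LinearMap.congr_fun hgf y
  have h₃ := LinearMap.congr_fun (comp_eq_zero_of_mem_coboundaries hd hv) y
  simp only [LinearMap.sub_apply, LinearMap.smul_apply, LinearMap.comp_apply,
    LinearMap.zero_apply] at h₁ h₂ h₃
  have h₄ := hs (w (d n y) - a • f y) (by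
    rw [smul_sub, ← h₁, h₃, h₂, sub_zero, smul_comm, sub_self])
  rw [smul_sub, sub_eq_zero] at h₄
  simpa [mul_smul] using h₄

lemma exists_smul_mem_coboundaries_of_smul_mem (hs : ∀ y : N, x • y = 0 → s • y = 0) (hsp : s ∉ p)
    (hd : ∀ n, d n ∘ₗ d (n + 1) = 0) (hq : Function.Surjective q)
    (hqx : ∀ y, q y = 0 ↔ ∃ z, y = x • z) {n : ℕ}
    (hz : ∀ m, n = m + 1 → IsLocallyZero d p m N') {f : P n →ₗ[R] N}
    (hxf : x • f ∈ coboundaries d N n) : ∃ t ∉ p, t • f ∈ coboundaries d N n := by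
  cases n with
  | zero =>
    refine ⟨s, hsp, LinearMap.ext fun y ↦ hs _ (LinearMap.congr_fun hxf y)⟩
  | succ n =>
    obtain ⟨g, hg⟩ := hxf
    obtain ⟨t, ht, htg⟩ := hz n rfl (q ∘ₗ g) (LinearMap.ext fun y ↦
      (hqx _).2 ⟨f y, LinearMap.congr_fun hg y⟩)
    exact ⟨s * t, ‹p.IsPrime›.mul_notMem hsp ht,
      smul_mem_coboundaries_of_comp_eq_smul hd hq (fun y ↦ (hqx y).1) hs hg htg⟩

lemma isLocallyZero_of_pow_smul_mem (hs : ∀ y : N, x • y = 0 → s • y = 0) (hsp : s ∉ p)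
    (hd : ∀ n, d n ∘ₗ d (n + 1) = 0) (hq : Function.Surjective q)
    (hqx : ∀ y, q y = 0 ↔ ∃ z, y = x • z) {n e : ℕ}
    (hz : ∀ m, n = m + 1 → IsLocallyZero d p m N')
    (he : ∀ f : P n →ₗ[R] N, f ∘ₗ d n = 0 → x ^ e • f ∈ coboundaries d N n) :
    IsLocallyZero d p n N := by
  have key : ∀ (e : ℕ) (f : P n →ₗ[R] N), x ^ e • f ∈ coboundaries d N n →
      ∃ t ∉ p, t • f ∈ coboundaries d N n := by
    intro e
    induction e with
    | zero => exact fun f hf ↦ ⟨1, ‹p.IsPrime›.one_notMem, by simpa using hf⟩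
    | succ e ih =>
      intro f hf
      obtain ⟨t, ht, htf⟩ := ih (x • f) (by rwa [smul_smul, ← pow_succ])
      obtain ⟨t', ht', htf'⟩ := exists_smul_mem_coboundaries_of_smul_mem hs hsp hd hq hqx hz
        (f := t • f) (by rwa [smul_comm])
      exact ⟨t' * t, ‹p.IsPrime›.mul_notMem ht' ht, by rwa [mul_smul]⟩
  exact fun f hf ↦ key e f (he f hf)

lemma isLocallyAssociated_succ_iff (hs : ∀ y : N, x • y = 0 → s • y = 0) (hsp : s ∉ p)
    (hxp : x ∈ p) (hd : ∀ n, d n ∘ₗ d (n + 1) = 0) (hq : Function.Surjective q)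
    (hqx : ∀ y, q y = 0 ↔ ∃ z, y = x • z) {n : ℕ} (hz : IsLocallyZero d p n N) :
    IsLocallyAssociated d p (n + 1) N ↔ IsLocallyAssociated d p n N' := by
  have hp : p.IsPrime := inferInstance
  constructor
  · rintro ⟨f, hf, hfp⟩
    obtain ⟨t, ht, g, hg⟩ := (hfp x).2 hxp
    replace hg : g ∘ₗ d n = x • (t • f) := by rw [smul_smul, mul_comm x]; exact hg
    refine ⟨q ∘ₗ g, LinearMap.ext fun y ↦ (hqx _).2 ⟨t • f y, LinearMap.congr_fun hg y⟩,
      fun a ↦ ⟨?_, fun ha ↦ ?_⟩⟩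
    · rintro ⟨u, hu, h⟩
      have h' := smul_mem_coboundaries_of_comp_eq_smul hd hq (fun y ↦ (hqx y).1) hs hg h
      refine (hfp a).1 ⟨s * u * t, hp.mul_notMem (hp.mul_notMem hsp hu) ht, ?_⟩
      rw [smul_smul] at h'
      convert h' using 2
      ring
    · obtain ⟨u, hu, h⟩ := (hfp a).2 ha
      obtain ⟨v, hv, h'⟩ := exists_smul_comp_mem_coboundaries hqx hz hg (a := u * a) (by
        rw [smul_comm]; exact Submodule.smul_mem _ _ h)
      exact ⟨v * u, hp.mul_notMem hv hu, by rwa [mul_assoc]⟩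
  · rintro ⟨h, hh, hhp⟩
    obtain ⟨g, rfl⟩ := Module.projective_lifting_property q h hq
    obtain ⟨f, hf⟩ := exists_smul_eq_of_comp_eq_zero (u := g ∘ₗ d n) (fun y ↦ (hqx y).1)
      (by rw [← LinearMap.comp_assoc, hh])
    refine ⟨s • f, LinearMap.ext fun y ↦ hs _ ?_, fun a ↦ ⟨?_, fun ha ↦ ?_⟩⟩
    · have h₁ := LinearMap.congr_fun hf (d (n + 1) y)
      have h₂ := congrArg g (LinearMap.congr_fun (hd n) y)
      simp only [LinearMap.smul_apply, LinearMap.comp_apply, LinearMap.zero_apply, map_zero]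
        at h₁ h₂ ⊢
      rw [← h₁, h₂]
    · rintro ⟨t, ht, h⟩
      obtain ⟨u, hu, h'⟩ := exists_smul_comp_mem_coboundaries hqx hz hf (a := t * a * s)
        (by rwa [mul_smul])
      refine (hhp a).1 ⟨u * t * s, hp.mul_notMem (hp.mul_notMem hu ht) hsp, ?_⟩
      convert h' using 2
      ring
    · obtain ⟨t, ht, h⟩ := (hhp a).2 ha
      have h' := smul_mem_coboundaries_of_comp_eq_smul hd hq (fun y ↦ (hqx y).1) hs hf h
      refine ⟨s * t, hp.mul_notMem hsp ht, ?_⟩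
      rw [smul_comm]
      refine Submodule.smul_mem _ _ ?_
      rwa [mul_assoc]

end Connecting

lemma isLocallyAssociated_iff_zero {p : Ideal R} [p.IsPrime] {l : ℕ}
    (hd : ∀ n, d n ∘ₗ d (n + 1) = 0) (F : ℕ → Type) [∀ n, AddCommGroup (F n)] [∀ n, Module R (F n)]
    (q : ∀ n, F n →ₗ[R] F (n + 1)) (x : ℕ → R) (hq : ∀ n, Function.Surjective (q n))
    (hqx : ∀ n < l, ∀ y, q n y = 0 ↔ ∃ z, y = x n • z)
    (hs : ∀ n < l, ∃ s ∉ p, ∀ y : F n, x n • y = 0 → s • y = 0) (hxp : ∀ n < l, x n ∈ p)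
    (he : ∀ n < l, ∃ e, ∀ m i, ∀ f : P m →ₗ[R] F i, f ∘ₗ d m = 0 →
      x n ^ e • f ∈ coboundaries d (F i) m) :
    IsLocallyAssociated d p l (F 0) ↔ IsLocallyAssociated d p 0 (F l) := by
  have hzero : ∀ i j, i + j < l → IsLocallyZero d p i (F j) := by
    intro i
    induction i with
    | zero =>
      intro j hj
      obtain ⟨s, hsp, hs⟩ := hs j (by lia)
      obtain ⟨e, he⟩ := he j (by lia)
      exact isLocallyZero_of_pow_smul_mem hs hsp hd (hq j) (hqx j (by lia)) (by simp) (he _ _)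
    | succ i ih =>
      intro j hj
      obtain ⟨s, hsp, hs⟩ := hs j (by lia)
      obtain ⟨e, he⟩ := he j (by lia)
      refine isLocallyZero_of_pow_smul_mem hs hsp hd (hq j) (hqx j (by lia)) (fun m hm ↦ ?_)
        (he _ _)
      obtain rfl : i = m := by lia
      exact ih _ (by lia)
  have hass : ∀ i j, i + j = l →
      (IsLocallyAssociated d p i (F j) ↔ IsLocallyAssociated d p 0 (F l)) := by
    intro i
    induction i with
    | zero =>
      intro j hj
      obtain rfl : j = l := by lia
      rfl
    | succ i ih =>
      intro j hj
      obtain ⟨s, hsp, hs⟩ := hs j (by lia)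
      rw [← ih (j + 1) (by lia)]
      exact isLocallyAssociated_succ_iff hs hsp (hxp j (by lia)) hd (hq j) (hqx j (by lia))
        (hzero i j (by lia))
  exact hass l 0 rfl

end Complex

section AssociatedPrimes

variable {R : Type} [CommRing R]

lemma mem_associatedPrimes_iff_local [IsNoetherianRing R] {X : Type} [AddCommGroup X] [Module R X] {p : Ideal R}
    [hp : p.IsPrime] :
    p ∈ associatedPrimes R X ↔ ∃ e : X, ∀ a, (∃ t ∉ p, (t * a) • e = 0) ↔ a ∈ p := by
  rw [AssociatedPrimes.mem_iff, isAssociatedPrime_iff]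
  simp only [hp, true_and]
  constructor
  · rintro ⟨e, he⟩
    refine ⟨e, fun a ↦ ⟨?_, fun ha ↦ ⟨1, hp.one_notMem, ?_⟩⟩⟩
    · rintro ⟨t, ht, h⟩
      refine (hp.mem_or_mem (?_ : t * a ∈ p)).resolve_left ht
      rw [he]
      simpa [Submodule.mem_colon_singleton] using h
    · rw [he] at ha
      simpa [Submodule.mem_colon_singleton] using ha
  · rintro ⟨e, he⟩
    obtain ⟨S, hS⟩ : p.FG := IsNoetherian.noetherian p
    have h (a : R) : ∃ t ∉ p, a ∈ p → (t * a) • e = 0 := by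
      by_cases ha : a ∈ p
      · obtain ⟨t, ht, h⟩ := (he a).2 ha
        exact ⟨t, ht, fun _ ↦ h⟩
      · exact ⟨1, hp.one_notMem, fun h ↦ absurd h ha⟩
    choose t ht hte using h
    have hu : ∏ a ∈ S, t a ∉ p := fun h ↦ by
      obtain ⟨a, -, ha⟩ := hp.prod_mem_iff.1 h
      exact ht a ha
    refine ⟨(∏ a ∈ S, t a) • e, le_antisymm ?_ fun a ha ↦ ?_⟩
    · conv_lhs => rw [← hS]
      rw [Submodule.span_le]
      intro a ha
      obtain ⟨c, hc⟩ := Finset.dvd_prod_of_mem t ha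
      rw [SetLike.mem_coe, Submodule.mem_colon_singleton, Submodule.mem_bot, smul_smul, hc,
        show a * (t a * c) = c * (t a * a) by ring, mul_smul,
        hte a (by rw [← hS]; exact Ideal.subset_span ha), smul_zero]
    · rw [Submodule.mem_colon_singleton, Submodule.mem_bot, smul_smul, mul_comm] at ha
      exact (he a).1 ⟨_, hu, ha⟩

lemma mem_associatedPrimes_homology_iff [IsNoetherianRing R] (S : ShortComplex (ModuleCat.{0} R)) {p : Ideal R}
    [hp : p.IsPrime] :
    p ∈ associatedPrimes R S.homology ↔ ∃ f : S.X₂, S.g f = 0 ∧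
      ∀ a, (∃ t ∉ p, (t * a) • f ∈ LinearMap.range S.f.hom) ↔ a ∈ p := by
  rw [LinearEquiv.AssociatedPrimes.eq S.moduleCatHomologyIso.toLinearEquiv,
    mem_associatedPrimes_iff_local]
  have key (z : LinearMap.ker S.g.hom) (a : R) :
      a • (LinearMap.range S.moduleCatToCycles).mkQ z = 0 ↔
        a • (z : S.X₂) ∈ LinearMap.range S.f.hom := by
    rw [← map_smul, Submodule.mkQ_apply, Submodule.Quotient.mk_eq_zero]
    constructor
    · rintro ⟨y, hy⟩
      exact ⟨y, congrArg Subtype.val hy⟩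
    · rintro ⟨y, hy⟩
      exact ⟨y, Subtype.ext hy⟩
  constructor
  · rintro ⟨e, he⟩
    obtain ⟨z, rfl⟩ := Submodule.mkQ_surjective _ e
    exact ⟨z, z.2, fun a ↦
      (exists_congr fun t ↦ and_congr Iff.rfl (key z (t * a))).symm.trans (he a)⟩
  · rintro ⟨f, hf, h⟩
    exact ⟨(LinearMap.range S.moduleCatToCycles).mkQ ⟨f, hf⟩, fun a ↦
      (exists_congr fun t ↦ and_congr Iff.rfl (key ⟨f, hf⟩ (t * a))).trans (h a)⟩

variable {M N : Type} [AddCommGroup M] [Module R M] [AddCommGroup N] [Module R N]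
  (P : ProjectiveResolution (ModuleCat.of R M))

/-- The terms of a projective resolution. -/
abbrev ResolutionX (n : ℕ) : Type := P.complex.X n

/-- The differentials of a projective resolution, as linear maps. -/
noncomputable def resolutionD (n : ℕ) : ResolutionX P (n + 1) →ₗ[R] ResolutionX P n :=
  (P.complex.d (n + 1) n).hom

lemma mem_associatedPrimes_ext_iff [IsNoetherianRing R] {p : Ideal R} [hp : p.IsPrime] (n : ℕ) :
    p ∈ associatedPrimes R
        (((Ext R (ModuleCat R) n).obj (op (ModuleCat.of R M))).obj (ModuleCat.of R N)) ↔
      IsLocallyAssociated (resolutionD P) p n N := by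
  rw [LinearEquiv.AssociatedPrimes.eq (P.isoExt n (ModuleCat.of R N)).toLinearEquiv]
  set K := P.complex.linearYonedaObj R (ModuleCat.of R N) with hK
  cases n with
  | zero =>
    refine (LinearEquiv.isAssociatedPrime_iff (ShortComplex.homologyMapIso
      (K.isoSc' 0 0 1 (by simp) (by simp))).toLinearEquiv).trans ?_
    refine (mem_associatedPrimes_homology_iff _).trans ?_
    have hf : (K.sc' 0 0 1).f.hom = 0 := by
      have : K.d 0 0 = 0 := K.shape 0 0 (by simp)
      exact congrArg ModuleCat.Hom.hom this
    rw [hf, LinearMap.range_zero]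
    refine (ModuleCat.homLinearEquiv (S := R)).toEquiv.exists_congr fun f ↦ and_congr ?_ ?_
    · exact (ModuleCat.homLinearEquiv (S := R)).map_eq_zero_iff.symm
    · refine forall_congr' fun a ↦ iff_congr (exists_congr fun t ↦ and_congr Iff.rfl ?_) Iff.rfl
      exact ((ModuleCat.homLinearEquiv (S := R)).map_eq_zero_iff (x := (t * a) • f)).symm
  | succ n =>
    refine (LinearEquiv.isAssociatedPrime_iff (ShortComplex.homologyMapIso
      (K.isoSc' n (n + 1) (n + 2) (by simp) (by simp))).toLinearEquiv).trans ?_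
    refine (mem_associatedPrimes_homology_iff _).trans ?_
    refine (ModuleCat.homLinearEquiv (S := R)).toEquiv.exists_congr fun f ↦ and_congr ?_ ?_
    · exact (ModuleCat.homLinearEquiv (S := R)).map_eq_zero_iff.symm
    · refine forall_congr' fun a ↦ iff_congr (exists_congr fun t ↦ and_congr Iff.rfl ?_) Iff.rfl
      refine (ModuleCat.homLinearEquiv (S := R)).toEquiv.exists_congr fun g ↦ ?_
      exact (ModuleCat.homLinearEquiv (S := R)).injective.eq_iff.symm

lemma resolutionD_comp (n : ℕ) : resolutionD P n ∘ₗ resolutionD P (n + 1) = 0 :=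
  congrArg ModuleCat.Hom.hom (P.complex.d_comp_d (n + 2) (n + 1) n)

lemma smul_mem_coboundaries_of_mem_annihilator {c : R} (hc : c ∈ Module.annihilator R M) {n : ℕ}
    {f : ResolutionX P n →ₗ[R] N} (hf : f ∘ₗ resolutionD P n = 0) :
    c • f ∈ coboundaries (resolutionD P) N n := by
  have h : Homotopy (c • 𝟙 P.complex) 0 := ProjectiveResolution.liftHomotopyZero _ (by
    ext : 1
    ext y
    exact ((P.π.f 0).hom.map_smul c y).trans
      (Module.mem_annihilator.1 hc ((P.π.f 0).hom y : M)))
  have hn := h.comm n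
  cases n with
  | zero =>
    rw [Homotopy.dNext_zero_chainComplex, Homotopy.prevD_chainComplex] at hn
    refine LinearMap.ext fun y ↦ ?_
    have h₁ := congrArg f (LinearMap.congr_fun (congrArg ModuleCat.Hom.hom hn) y)
    have h₂ := LinearMap.congr_fun hf (h.hom 0 1 y)
    simp [resolutionD] at h₁ h₂
    simp [h₁, h₂]
  | succ n =>
    rw [Homotopy.dNext_succ_chainComplex, Homotopy.prevD_chainComplex] at hn
    refine ⟨f ∘ₗ (h.hom n (n + 1)).hom, LinearMap.ext fun y ↦ ?_⟩
    have h₁ := congrArg f (LinearMap.congr_fun (congrArg ModuleCat.Hom.hom hn) y)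
    have h₂ := LinearMap.congr_fun hf (h.hom (n + 1) (n + 2) y)
    simp [resolutionD] at h₁ h₂
    simp [h₁, h₂, resolutionD]

lemma annihilator_le_of_isLocallyAssociated {p : Ideal R} {n : ℕ} [hp : p.IsPrime]
    (h : IsLocallyAssociated (resolutionD P) p n N) : Module.annihilator R M ≤ p := by
  obtain ⟨f, hf, h⟩ := h
  exact fun c hc ↦ (h c).1 ⟨1, hp.one_notMem, by
    rw [one_mul]; exact smul_mem_coboundaries_of_mem_annihilator P hc hf⟩

lemma mem_associatedPrimes_linearMap_iff [IsNoetherianRing R] [Module.Finite R M] {p : Ideal R} [hp : p.IsPrime]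
    (hM : Module.annihilator R M ≤ p) :
    p ∈ associatedPrimes R (M →ₗ[R] N) ↔ p ∈ associatedPrimes R N := by
  simp only [AssociatedPrimes.mem_iff, isAssociatedPrime_iff, hp, true_and]
  constructor
  · rintro ⟨φ, hφ⟩
    obtain ⟨S, hS⟩ := Module.Finite.fg_top (R := R) (M := M)
    have h : p = S.inf fun m ↦ (⊥ : Submodule R N).colon {φ m} := by
      rw [hφ]
      ext a
      simp only [Submodule.mem_colon_singleton, Submodule.mem_bot, Submodule.mem_finsetInf]
      refine ⟨fun h m _ ↦ LinearMap.congr_fun h m, fun h ↦ ?_⟩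
      refine LinearMap.ext_on hS (g := 0) fun m hm ↦ h m hm
    obtain ⟨m, hm, hmp⟩ := (hp.inf_le').1 h.ge
    exact ⟨φ m, le_antisymm (h.trans_le (Finset.inf_le hm)) hmp⟩
  · rintro ⟨y, hy⟩
    have : Nontrivial (M →ₗ[R] R ⧸ p) := by
      rw [← not_subsingleton_iff_nontrivial, IsSMulRegular.subsingleton_linearMap_iff]
      rintro ⟨c, hc, h⟩
      have h₀ : c • (1 : R ⧸ p) = c • 0 := by
        rw [smul_zero, Algebra.smul_def, mul_one]
        exact Ideal.Quotient.eq_zero_iff_mem.2 (hM hc)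
      exact one_ne_zero (h h₀)
    obtain ⟨ψ, hψ⟩ := exists_ne (0 : M →ₗ[R] R ⧸ p)
    have hker : p = LinearMap.ker (LinearMap.toSpanSingleton R N y) := by
      rw [hy]
      ext a
      simp [Submodule.mem_colon_singleton]
    set ι : R ⧸ p →ₗ[R] N := Submodule.liftQ p (LinearMap.toSpanSingleton R N y) hker.le
    have hι : Function.Injective ι := by
      rw [← LinearMap.ker_eq_bot, Submodule.ker_liftQ_eq_bot _ _ _ hker.ge]
    refine ⟨ι ∘ₗ ψ, Ideal.ext fun a ↦ ?_⟩
    rw [Submodule.mem_colon_singleton, Submodule.mem_bot]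
    have hz (m : M) : a • ψ m = Ideal.Quotient.mk p a * ψ m := by
      rw [Algebra.smul_def]; rfl
    constructor
    · intro ha
      ext m
      simp only [LinearMap.smul_apply, LinearMap.comp_apply, ← map_smul ι, hz,
        Ideal.Quotient.eq_zero_iff_mem.2 ha, zero_mul, map_zero, LinearMap.zero_apply]
    · intro ha
      by_contra hap
      refine hψ (LinearMap.ext fun m ↦ ?_)
      have h := LinearMap.congr_fun ha m
      simp only [LinearMap.smul_apply, LinearMap.comp_apply, ← map_smul ι, hz,
        LinearMap.zero_apply] at h
      exact (mul_eq_zero.1 ((map_eq_zero_iff ι hι).1 h)).resolve_left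
        fun h ↦ hap (Ideal.Quotient.eq_zero_iff_mem.1 h)

lemma isLocallyAssociated_zero_iff [IsNoetherianRing R] [Module.Finite R M] {p : Ideal R} [hp : p.IsPrime]
    (hM : Module.annihilator R M ≤ p) :
    IsLocallyAssociated (resolutionD P) p 0 N ↔ p ∈ associatedPrimes R N := by
  rw [← mem_associatedPrimes_linearMap_iff hM, mem_associatedPrimes_iff_local]
  let ε : ResolutionX P 0 →ₗ[R] M := (P.π.f 0).hom
  have hε : Function.Surjective ε := (ModuleCat.epi_iff_surjective (P.π.f 0)).1 inferInstance
  have hker : LinearMap.range (resolutionD P 0) = LinearMap.ker ε :=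
    P.exact₀.moduleCat_range_eq_ker
  have key (φ : M →ₗ[R] N) (c : R) :
      c • (φ ∘ₗ ε) ∈ coboundaries (resolutionD P) N 0 ↔ c • φ = 0 := by
    refine ⟨fun h ↦ LinearMap.ext fun m ↦ ?_, fun h ↦ ?_⟩
    · obtain ⟨y, rfl⟩ := hε m
      exact LinearMap.congr_fun h y
    · rw [← LinearMap.smul_comp, h, LinearMap.zero_comp]
      exact zero_mem _
  constructor
  · rintro ⟨f, hf, h⟩
    obtain ⟨φ, rfl⟩ : ∃ φ : M →ₗ[R] N, φ ∘ₗ ε = f := by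
      refine ⟨(Submodule.liftQ (LinearMap.ker ε) f ?_) ∘ₗ
        (ε.quotKerEquivOfSurjective hε).symm.toLinearMap, LinearMap.ext fun y ↦ ?_⟩
      · rw [← hker]
        exact LinearMap.range_le_ker_iff.2 hf
      · have : (ε.quotKerEquivOfSurjective hε).symm (ε y) = Submodule.Quotient.mk y := by
          rw [LinearEquiv.symm_apply_eq, LinearMap.quotKerEquivOfSurjective_apply_mk]
        simp [this]
    exact ⟨φ, by simpa only [key] using h⟩
  · rintro ⟨φ, h⟩
    refine ⟨φ ∘ₗ ε, ?_, by simpa only [key] using h⟩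
    rw [LinearMap.comp_assoc, LinearMap.range_le_ker_iff.1 hker.le, LinearMap.comp_zero]

end AssociatedPrimes

section DimensionSequence

variable {R : Type} [CommRing R]

lemma zdim_lt_ringKrullDim_quotient_of_lt [IsNoetherianRing R] [IsLocalRing R] {k : ℤ} {p q : Ideal R} [p.IsPrime]
    [q.IsPrime] (hqp : q < p) (hp : p ∈ dimGE R k) : zdim k < ringKrullDim (R ⧸ q) := by
  obtain ⟨a, hap, haq⟩ := SetLike.exists_of_lt hqp
  have h : ringKrullDim (R ⧸ p) + 1 ≤ ringKrullDim (R ⧸ q) :=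
    ringKrullDim_succ_le_of_surjective (Ideal.Quotient.factor hqp.le)
      (Ideal.Quotient.factor_surjective hqp.le) (r := Ideal.Quotient.mk q a)
      (mem_nonZeroDivisors_of_ne_zero fun h ↦ haq (Ideal.Quotient.eq_zero_iff_mem.1 h))
      (Ideal.Quotient.eq_zero_iff_mem.2 hap)
  have : IsLocalRing (R ⧸ p) :=
    .of_surjective' (Ideal.Quotient.mk p) Ideal.Quotient.mk_surjective
  have hlt : ringKrullDim (R ⧸ p) < ringKrullDim (R ⧸ p) + 1 := by
    obtain ⟨n, hn⟩ : ∃ n : ℕ, ringKrullDim (R ⧸ p) = n :=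
      ⟨_, Order.krullDim_eq_length_of_finiteDimensionalOrder⟩
    rw [hn]
    exact_mod_cast n.lt_succ_self
  have hp' : zdim k ≤ ringKrullDim (R ⧸ p) := hp
  exact hp'.trans_lt (hlt.trans_le h)

lemma exists_notMem_forall_smul_eq_zero [IsNoetherianRing R] {N : Type} [AddCommGroup N] [Module R N]
    [Module.Finite R N] {p : Ideal R} [p.IsPrime] {x : R}
    (h : ∀ q ∈ associatedPrimes R N, q ≤ p → x ∉ q) :
    ∃ s ∉ p, ∀ y : N, x • y = 0 → s • y = 0 := by
  let K := LinearMap.ker (LinearMap.lsmul R N x)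
  by_contra! hK
  have hKp : Module.annihilator R K ≤ p := fun s hs ↦ by
    by_contra hsp
    obtain ⟨y, hy, hsy⟩ := hK s hsp
    exact hsy (congrArg Subtype.val (Module.mem_annihilator.1 hs ⟨y, hy⟩))
  obtain ⟨q, hq, hqp⟩ := Ideal.exists_minimalPrimes_le hKp
  have hqK := Module.associatedPrimes.minimalPrimes_annihilator_subset_associatedPrimes R K hq
  refine h q (associatedPrimes.subset_of_injective K.injective_subtype hqK) hqp (hq.1.2 ?_)
  exact Module.mem_annihilator.2 fun y ↦ Subtype.ext y.2

lemma prefIdeal_mono {r : ℕ} (x : Fin r → R) {i j : ℕ} (h : i ≤ j) :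
    prefIdeal x i ≤ prefIdeal x j :=
  Ideal.span_mono (Set.image_mono fun _ hi ↦ lt_of_lt_of_le hi h)

lemma prefIdeal_succ {r : ℕ} (x : Fin r → R) {n : ℕ} (h : n < r) :
    prefIdeal x (n + 1) = prefIdeal x n ⊔ Ideal.span {x ⟨n, h⟩} := by
  rw [prefIdeal, prefIdeal, ← Ideal.span_union, ← Set.image_singleton, ← Set.image_union]
  congr 2
  ext i
  simp only [Set.mem_ofPred_eq, Set.mem_union, Set.mem_singleton_iff, Fin.ext_iff]
  lia

variable (N : Type) [AddCommGroup N] [Module R N]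

/-- The projection `N/(x_0,…,x_{n-1})N → N/(x_0,…,x_n)N`. -/
def prefQuotientFactor {r : ℕ} (x : Fin r → R) (n : ℕ) :
    (N ⧸ (prefIdeal x n • ⊤ : Submodule R N)) →ₗ[R]
      N ⧸ (prefIdeal x (n + 1) • ⊤ : Submodule R N) :=
  Submodule.factor (Submodule.smul_mono_left (prefIdeal_mono x n.le_succ))

lemma prefQuotientFactor_eq_zero_iff {r : ℕ} (x : Fin r → R) {n : ℕ} (h : n < r)
    (y : N ⧸ (prefIdeal x n • ⊤ : Submodule R N)) :
    prefQuotientFactor N x n y = 0 ↔ ∃ z, y = x ⟨n, h⟩ • z := by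
  obtain ⟨y, rfl⟩ := Submodule.Quotient.mk_surjective _ y
  have : prefQuotientFactor N x n (Submodule.Quotient.mk y) = Submodule.Quotient.mk y := rfl
  rw [this, Submodule.Quotient.mk_eq_zero, prefIdeal_succ x h, Submodule.sup_smul,
    Submodule.ideal_span_singleton_smul, Submodule.mem_sup]
  constructor
  · rintro ⟨a, ha, b, hb, rfl⟩
    obtain ⟨z, -, rfl⟩ := (Submodule.mem_smul_pointwise_iff_exists _ _ _).1 hb
    refine ⟨Submodule.Quotient.mk z, ?_⟩
    rw [Submodule.Quotient.mk_add, (Submodule.Quotient.mk_eq_zero _).2 ha, zero_add,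
      Submodule.Quotient.mk_smul]
  · rintro ⟨z, hz⟩
    obtain ⟨z, rfl⟩ := Submodule.Quotient.mk_surjective _ z
    rw [← Submodule.Quotient.mk_smul, Submodule.Quotient.eq] at hz
    exact ⟨_, hz, _, Submodule.smul_mem_pointwise_smul z (x ⟨n, h⟩) ⊤ trivial,
      sub_add_cancel _ _⟩

variable {N}

lemma mem_associatedPrimes_ext_iff_of_forall_notMem [IsNoetherianRing R] [IsLocalRing R]
     [Module.Finite R N]
    {M : Type} [AddCommGroup M] [Module R M] [Module.Finite R M] {k : ℤ} {r : ℕ} {x : Fin r → R}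
    (hxI : ∀ i, x i ∈ (Module.annihilator R M).radical) (hx : IsSeqInDimGT R N k x)
    {p : Ideal R} [hp : p.IsPrime] (hpk : p ∈ dimGE R k) (hpM : Module.annihilator R M ≤ p)
    {l : ℕ} (hl : l ≤ r)
    (h : ∀ n < l, p ∉ associatedPrimes R (N ⧸ (prefIdeal x n • ⊤ : Submodule R N))) :
    p ∈ associatedPrimes R
        (((Ext R (ModuleCat R) l).obj (op (ModuleCat.of R M))).obj (ModuleCat.of R N)) ↔
      p ∈ associatedPrimes R (N ⧸ (prefIdeal x l • ⊤ : Submodule R N)) := by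
  let P := projectiveResolution (ModuleCat.of R M)
  have (n : ℕ) : Module.Projective R (ResolutionX P n) :=
    (IsProjective.iff_projective (ResolutionX P n)).2 (P.projective n)
  let F (n : ℕ) : Type := N ⧸ (prefIdeal x n • ⊤ : Submodule R N)
  let y (n : ℕ) : R := if hn : n < r then x ⟨n, hn⟩ else 0
  have hy {n : ℕ} (hn : n < l) : y n = x ⟨n, hn.trans_le hl⟩ := dif_pos _
  have hbot : (prefIdeal x 0 • ⊤ : Submodule R N) = ⊥ := by
    simp [prefIdeal]
  rw [LinearEquiv.AssociatedPrimes.eq (((Ext R (ModuleCat R) l).obj (op (ModuleCat.of R M))).mapIso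
      (Submodule.quotEquivOfEqBot _ hbot).symm.toModuleIso).toLinearEquiv,
    mem_associatedPrimes_ext_iff P, ← isLocallyAssociated_zero_iff P hpM]
  refine isLocallyAssociated_iff_zero (resolutionD_comp P) F (prefQuotientFactor N x) y
    (fun n ↦ Submodule.factor_surjective
      (Submodule.smul_mono_left (prefIdeal_mono x n.le_succ)))
    (fun n hn z ↦ ?_) (fun n hn ↦ ?_) (fun n hn ↦ ?_)
    (fun n hn ↦ ?_)
  · rw [hy hn]
    exact prefQuotientFactor_eq_zero_iff N x (hn.trans_le hl) z
  · refine exists_notMem_forall_smul_eq_zero fun q hq hqp ↦ ?_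
    have : q.IsPrime := hq.isPrime
    rw [hy hn]
    refine hx ⟨n, hn.trans_le hl⟩ q hq (zdim_lt_ringKrullDim_quotient_of_lt (p := p) ?_ hpk)
    exact lt_of_le_of_ne hqp fun hqp ↦ h n hn (hqp ▸ hq)
  · rw [hy hn]
    exact hp.radical_le_iff.2 hpM (hxI _)
  · obtain ⟨e, he⟩ := hxI ⟨n, hn.trans_le hl⟩
    rw [hy hn]
    exact ⟨e, fun m i f hf ↦ smul_mem_coboundaries_of_mem_annihilator P he hf⟩

end DimensionSequence

/-- Corollary (Ext version): if `r = depth_k(ann M, N) < ∞` and `x₁,…,x_r` is an `N`-sequence in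
dimension `> k` contained in `√(ann M)`, then for every `l ≤ r`,
`⋃_{j≤l} Ass_R(Ext^j_R(M,N))_{≥k} = ⋃_{j≤l} Ass_R(N/(x₁,…,x_j)N)_{≥k} ∩ V(ann M)`. -/
theorem ass_ext_eq (R : Type) [CommRing R] [IsNoetherianRing R] [IsLocalRing R]
    (M N : Type) [AddCommGroup M] [Module R M] [Module.Finite R M]
    [AddCommGroup N] [Module R N] [Module.Finite R N]
    (k : ℤ) (hk : -1 ≤ k) (r : ℕ) (hr : depthK R k (Module.annihilator R M) N = (r : ℕ∞))
    (x : Fin r → R) (hxI : ∀ i, x i ∈ (Module.annihilator R M).radical)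
    (hx : IsSeqInDimGT R N k x) (l : ℕ) (hl : l ≤ r) :
    (⋃ j ≤ l, associatedPrimes R
        (((Ext R (ModuleCat R) j).obj (op (ModuleCat.of R M))).obj (ModuleCat.of R N))
        ∩ dimGE R k)
      = ⋃ j ≤ l, (associatedPrimes R (N ⧸ (prefIdeal x j • ⊤ : Submodule R N))
          ∩ dimGE R k ∩ {p | Module.annihilator R M ≤ p}) := by
  have key {p : Ideal R} (hp : p.IsPrime) (hpk : p ∈ dimGE R k)
      (hpM : Module.annihilator R M ≤ p) {j : ℕ} (hj : j ≤ l)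
      (h : ∀ n < j, p ∉ associatedPrimes R (N ⧸ (prefIdeal x n • ⊤ : Submodule R N))) :=
    mem_associatedPrimes_ext_iff_of_forall_notMem hxI hx hpk hpM (hj.trans hl) h
  ext p
  simp only [Set.mem_iUnion, Set.mem_inter_iff, Set.mem_ofPred_eq, exists_prop]
  constructor
  · rintro ⟨j, hj, hpj, hpk⟩
    have hp : p.IsPrime := hpj.isPrime
    have hpM : Module.annihilator R M ≤ p :=
      annihilator_le_of_isLocallyAssociated (projectiveResolution (ModuleCat.of R M))
        ((mem_associatedPrimes_ext_iff _ j).1 hpj)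
    by_contra! h
    have h' (n : ℕ) (hn : n ≤ j) :
        p ∉ associatedPrimes R (N ⧸ (prefIdeal x n • ⊤ : Submodule R N)) :=
      fun hpn ↦ h n (hn.trans hj) ⟨hpn, hpk⟩ hpM
    exact h' j le_rfl ((key hp hpk hpM hj fun n hn ↦ h' n hn.le).1 hpj)
  · rintro ⟨j, hj, ⟨hpj, hpk⟩, hpM⟩
    classical
    have hex : ∃ j, p ∈ associatedPrimes R (N ⧸ (prefIdeal x j • ⊤ : Submodule R N)) := ⟨j, hpj⟩
    have hle : Nat.find hex ≤ l := (Nat.find_min' hex hpj).trans hj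
    exact ⟨Nat.find hex, hle, (key hpj.isPrime hpk hpM hle fun n hn ↦ Nat.find_min hex hn).2
      (Nat.find_spec hex), hpk⟩
end

section
/- Let (R,m) be a Noetherian local ring, I an ideal, N a finitely generated R-module, k ≥ -1 an integer, r ≥ 0. Assume dim Supp H^i_I(N) ≤ k for all i < r. Then for every j ≤ r and every positive integer t, the set {p ∈ Ass_R(Ext^j_R(R/I^t, N)) : dim(R/p) ≥ k} is contained in the finite set ⋃_{i≤j} Ass_R(Ext^i_R(R/I, N)). -/
open CategoryTheory Opposite IsLocalRing

section Bridge
universe w v u t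
open Limits

variable {R : Type t} [CommRing R] {C : Type u} [Category.{v} C] [Abelian C] [Linear R C]

namespace CategoryTheory.ProjectiveResolution

theorem extMk_eq_zero_iff_exists [HasExt.{w} C] {X Y : C} (P : ProjectiveResolution X) {n : ℕ} (f : P.complex.X n ⟶ Y)
    (hf : P.complex.d (n + 1) n ≫ f = 0) :
    P.extMk f (n + 1) rfl hf = 0 ↔
      f ∈ Set.range (fun g : P.complex.X ((ComplexShape.down ℕ).next n) ⟶ Y ↦
        P.complex.d n ((ComplexShape.down ℕ).next n) ≫ g) := by
  cases n with
  | zero =>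
    have h0 : P.complex.d 0 ((ComplexShape.down ℕ).next 0) = 0 := P.complex.shape _ _ (by simp)
    simp only [h0, zero_comp, Set.mem_range, exists_const]
    simp only [← P.extEquivCohomologyClass.apply_eq_iff_eq,
      extEquivCohomologyClass_extMk, extEquivCohomologyClass_zero,
      CochainComplex.HomComplex.CohomologyClass.mk_eq_zero_iff]
    rw [CochainComplex.HomComplex.Cocycle.toSingleMk_mem_coboundaries_iff _ _ _ _ _ 1 (by lia)]
    have hz : IsZero (P.cochainComplex.X 1) := CochainComplex.isZero_of_isStrictlyLE _ 0 _
    constructor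
    · rintro ⟨g, hg⟩
      rw [hz.eq_of_src g 0, comp_zero] at hg
      rw [← cancel_epi (P.cochainComplexXIso (-(0 : ℕ)) 0 rfl).hom, comp_zero]
      exact hg
    · rintro rfl
      exact ⟨0, by simp⟩
  | succ n =>
    have : (ComplexShape.down ℕ).next (n + 1) = n := by simp
    rw [P.extMk_eq_zero_iff f _ rfl hf n rfl, this]
    rfl

theorem smul_extMk [HasExt.{w} C] {X Y : C} (P : ProjectiveResolution X) {n : ℕ} (f : P.complex.X n ⟶ Y)
    (hf : P.complex.d (n + 1) n ≫ f = 0) (r : R) :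
    r • P.extMk f (n + 1) rfl hf = P.extMk (r • f) (n + 1) rfl (by simp [hf]) := by
  rw [Abelian.Ext.smul_eq_comp_mk₀, extMk_comp_mk₀]
  congr 1
  simp

/-- The chain map `Hom(L, Y) ⟶ Hom(K, Y)` induced by a chain map `K ⟶ L`. -/
noncomputable def linearYonedaMap (R : Type t) [CommRing R] [Linear R C] {K L : ChainComplex C ℕ} (φ : K ⟶ L) (Y : C) :
    L.linearYonedaObj R Y ⟶ K.linearYonedaObj R Y :=
  (HomologicalComplex.unopFunctor _ _).map
    ((((linearYoneda R C).obj Y).rightOp.mapHomologicalComplex _).map φ).op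

theorem _root_.CategoryTheory.comp_unop_eq_of_op_squares {D : Type*} [Category D] {A A' B B' E E' : Dᵒᵖ}
    (a : A ≅ B) (a' : A' ≅ B') (h : B ≅ E) (h' : B' ≅ E') (m : A' ⟶ A) (b : B' ⟶ B)
    (e : E' ⟶ E) (h1 : a'.inv ≫ m = b ≫ a.inv) (h2 : b ≫ h.hom = h'.hom ≫ e) :
    m.unop ≫ a'.inv.unop ≫ h'.inv.unop = (a.inv.unop ≫ h.inv.unop) ≫ e.unop := by
  apply Quiver.Hom.op_inj
  simp only [op_comp, Quiver.Hom.op_unop, Category.assoc]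
  rw [h1, ← cancel_epi h'.hom, Iso.hom_inv_id_assoc, ← reassoc_of% h2, Iso.hom_inv_id_assoc]

variable (R) in
/-- The cocycle of `Hom(P, Y)` underlying an element of the kernel of the differential. -/
noncomputable def cyclesHom {X : C} (P : ProjectiveResolution X) (n : ℕ) (Y : C) :
    (P.complex.linearYonedaObj R Y).cycles n →ₗ[R] (P.complex.X n ⟶ Y) :=
  ((P.complex.linearYonedaObj R Y).iCycles n).hom

theorem d_comp_cyclesHom {X : C} (P : ProjectiveResolution X) (n : ℕ) (Y : C)
    (z : (P.complex.linearYonedaObj R Y).cycles n) :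
    P.complex.d (n + 1) n ≫ P.cyclesHom R n Y z = 0 :=
  congr($((P.complex.linearYonedaObj R Y).iCycles_d n (n + 1)).hom z)

theorem cyclesHom_cyclesMap {X X' : C} {P : ProjectiveResolution X}
    {P' : ProjectiveResolution X'} (φ : P'.complex ⟶ P.complex) (n : ℕ) (Y : C)
    (z : (P.complex.linearYonedaObj R Y).cycles n) :
    P'.cyclesHom R n Y ((HomologicalComplex.cyclesMap (linearYonedaMap R φ Y) n).hom z) =
      φ.f n ≫ P.cyclesHom R n Y z :=
  congr($(HomologicalComplex.cyclesMap_i (linearYonedaMap R φ Y) n).hom z)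

variable (R) in
/-- The class in `Ext` of a cocycle of `Hom(P, Y)`. -/
noncomputable def cyclesToExt [HasExt.{w} C] {X : C} (P : ProjectiveResolution X) (n : ℕ) (Y : C) :
    (P.complex.linearYonedaObj R Y).cycles n →ₗ[R] Abelian.Ext X Y n where
  toFun z := P.extMk (P.cyclesHom R n Y z) (n + 1) rfl (P.d_comp_cyclesHom n Y z)
  map_add' x y := by
    rw [add_extMk]
    simp only [map_add]
  map_smul' r x := by
    rw [RingHom.id_apply, smul_extMk]
    simp only [map_smul]

theorem cyclesToExt_surjective [HasExt.{w} C] {X : C} (P : ProjectiveResolution X) (n : ℕ) (Y : C) :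
    Function.Surjective (P.cyclesToExt R n Y) := by
  intro α
  obtain ⟨f, hf, rfl⟩ := P.extMk_surjective α (n + 1) rfl
  refine ⟨(P.complex.linearYonedaObj R Y).cyclesMk (i := n) f (n + 1) (by simp) hf, ?_⟩
  dsimp [cyclesToExt]
  congr 1
  exact (P.complex.linearYonedaObj R Y).i_cyclesMk (i := n) f (n + 1) (by simp) hf

theorem ker_cyclesToExt [HasExt.{w} C] {X : C} (P : ProjectiveResolution X) (n : ℕ) (Y : C) :
    LinearMap.ker (P.cyclesToExt R n Y) =
      LinearMap.ker ((P.complex.linearYonedaObj R Y).homologyπ n).hom := by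
  let K := P.complex.linearYonedaObj R Y
  have hex : (ShortComplex.mk _ _
      (K.toCycles_comp_homologyπ ((ComplexShape.up ℕ).prev n) n)).Exact :=
    ShortComplex.exact_of_g_is_cokernel _ (K.homologyIsCokernel _ _ rfl)
  rw [ShortComplex.moduleCat_exact_iff_range_eq_ker] at hex
  refine Eq.trans ?_ hex
  ext z
  refine (P.extMk_eq_zero_iff_exists _ (P.d_comp_cyclesHom n Y z)).trans
    (exists_congr fun g ↦ ?_)
  have hinj : Function.Injective (P.cyclesHom R n Y) :=
    (ModuleCat.mono_iff_injective ((P.complex.linearYonedaObj R Y).iCycles n)).1 inferInstance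
  have hg : P.cyclesHom R n Y (((P.complex.linearYonedaObj R Y).toCycles
      ((ComplexShape.up ℕ).prev n) n).hom g) =
        P.complex.d n ((ComplexShape.up ℕ).prev n) ≫ g :=
    congr($((P.complex.linearYonedaObj R Y).toCycles_i ((ComplexShape.up ℕ).prev n) n).hom g)
  exact ⟨fun h ↦ hinj (hg.trans h), fun h ↦ hg.symm.trans congr(P.cyclesHom R n Y $h)⟩

variable [EnoughProjectives C]

theorem isoExt_hom_naturality {X X' Y : C} {P : ProjectiveResolution X}
    {P' : ProjectiveResolution X'} {g : X' ⟶ X} (φ : Hom P' P g) (n : ℕ) :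
    ((Ext R C n).map g.op).app Y ≫ (P'.isoExt n Y).hom =
      (P.isoExt n Y).hom ≫
        HomologicalComplex.homologyMap (linearYonedaMap R φ.hom Y) n := by
  have comm : φ.hom.f 0 ≫ P.π.f 0 = P'.π.f 0 ≫ g := by
    rw [φ.hom_f_zero_comp_π_f_zero, ChainComplex.single₀_map_f_zero]; rfl
  exact comp_unop_eq_of_op_squares _ _ (HomologicalComplex.homologyOp _ n)
    (HomologicalComplex.homologyOp _ n) _ _ _
    (P'.isoLeftDerivedObj_inv_naturality g P φ.hom comm ((linearYoneda R C).obj Y).rightOp n)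
    (HomologicalComplex.homologyOp_hom_naturality (linearYonedaMap R φ.hom Y) n)

variable (R) in
/-- The class in the derived functor `Ext` of a cocycle of `Hom(P, Y)`. -/
noncomputable def cyclesToDerived {X : C} (P : ProjectiveResolution X) (n : ℕ) (Y : C) :
    (P.complex.linearYonedaObj R Y).cycles n →ₗ[R] ((Ext R C n).obj (op X)).obj Y :=
  (P.isoExt n Y).toLinearEquiv.symm.toLinearMap ∘ₗ
    ((P.complex.linearYonedaObj R Y).homologyπ n).hom

theorem cyclesToDerived_surjective {X : C} (P : ProjectiveResolution X) (n : ℕ) (Y : C) :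
    Function.Surjective (P.cyclesToDerived R n Y) :=
  (P.isoExt n Y).toLinearEquiv.symm.surjective.comp
    ((ModuleCat.epi_iff_surjective ((P.complex.linearYonedaObj R Y).homologyπ n)).1 inferInstance)

theorem ker_cyclesToDerived {X : C} (P : ProjectiveResolution X) (n : ℕ) (Y : C) :
    LinearMap.ker (P.cyclesToDerived R n Y) =
      LinearMap.ker ((P.complex.linearYonedaObj R Y).homologyπ n).hom :=
  LinearEquiv.ker_comp _ _

theorem map_cyclesToDerived {X X' : C} {P : ProjectiveResolution X}
    {P' : ProjectiveResolution X'} {g : X' ⟶ X} (φ : Hom P' P g) (n : ℕ) (Y : C)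
    (z : (P.complex.linearYonedaObj R Y).cycles n) :
    (((Ext R C n).map g.op).app Y).hom (P.cyclesToDerived R n Y z) =
      P'.cyclesToDerived R n Y
        ((HomologicalComplex.cyclesMap (linearYonedaMap R φ.hom Y) n).hom z) := by
  have h1 := congr($(isoExt_hom_naturality (R := R) (Y := Y) φ n).hom (P.cyclesToDerived R n Y z))
  have h2 := congr($(HomologicalComplex.homologyπ_naturality
    (linearYonedaMap R φ.hom Y) n).hom z)
  refine (P'.isoExt (R := R) n Y).toLinearEquiv.injective (h1.trans ?_)
  refine (congrArg
    (HomologicalComplex.homologyMap (linearYonedaMap R φ.hom Y) n).hom ?_).trans (h2.trans ?_)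
  · exact (P.isoExt (R := R) n Y).toLinearEquiv.apply_symm_apply _
  · exact ((P'.isoExt (R := R) n Y).toLinearEquiv.apply_symm_apply _).symm

/-- The derived functor `Ext` is isomorphic to `Ext` defined in the derived category. -/
noncomputable def derivedEquivExt [HasExt.{w} C] {X : C} (P : ProjectiveResolution X) (n : ℕ)
    (Y : C) : ((Ext R C n).obj (op X)).obj Y ≃ₗ[R] Abelian.Ext X Y n :=
  ((P.cyclesToDerived R n Y).quotKerEquivOfSurjective (P.cyclesToDerived_surjective n Y)).symm ≪≫ₗ
    Submodule.quotEquivOfEq _ _ ((P.ker_cyclesToDerived n Y).trans (P.ker_cyclesToExt n Y).symm) ≪≫ₗ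
    (P.cyclesToExt R n Y).quotKerEquivOfSurjective (P.cyclesToExt_surjective n Y)

theorem derivedEquivExt_cyclesToDerived [HasExt.{w} C] {X : C} (P : ProjectiveResolution X) (n : ℕ)
    (Y : C) (z : (P.complex.linearYonedaObj R Y).cycles n) :
    P.derivedEquivExt n Y (P.cyclesToDerived R n Y z) = P.cyclesToExt R n Y z := by
  have : ((P.cyclesToDerived R n Y).quotKerEquivOfSurjective
      (P.cyclesToDerived_surjective n Y)).symm (P.cyclesToDerived R n Y z) =
        Submodule.Quotient.mk z := by
    rw [LinearEquiv.symm_apply_eq]; rfl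
  simp only [derivedEquivExt, LinearEquiv.trans_apply, this]
  rfl

theorem derivedEquivExt_map [HasExt.{w} C] {X X' : C} (P : ProjectiveResolution X)
    (P' : ProjectiveResolution X') (g : X' ⟶ X) (n : ℕ) (Y : C)
    (x : ((Ext R C n).obj (op X)).obj Y) :
    P'.derivedEquivExt n Y ((((Ext R C n).map g.op).app Y).hom x) =
      (Abelian.Ext.mk₀ g).comp (P.derivedEquivExt n Y x) (zero_add n) := by
  let φ : Hom P' P g := ⟨lift g P' P, HomologicalComplex.congr_hom (lift_commutes g P' P) 0⟩
  obtain ⟨z, rfl⟩ := P.cyclesToDerived_surjective n Y x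
  rw [map_cyclesToDerived φ, derivedEquivExt_cyclesToDerived, derivedEquivExt_cyclesToDerived]
  refine Eq.trans ?_ (mk₀_comp_extMk _ _ rfl (P.d_comp_cyclesHom n Y z) φ).symm
  simp only [cyclesToExt, LinearMap.coe_mk, AddHom.coe_mk, cyclesHom_cyclesMap]

end CategoryTheory.ProjectiveResolution
end Bridge
section LC
open localCohomology Abelian Limits
variable {R : Type} [CommRing R]

/-- The derived functor `Ext` of modules is isomorphic to `Ext` in the derived category. -/
noncomputable def ModuleCat.derivedEquivExt (X Y : ModuleCat.{0} R) (i : ℕ) :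
    ((_root_.Ext R (ModuleCat R) i).obj (op X)).obj Y ≃ₗ[R] Abelian.Ext X Y i :=
  (CategoryTheory.projectiveResolution X).derivedEquivExt i Y

theorem ModuleCat.derivedEquivExt_map {X X' : ModuleCat.{0} R} (g : X' ⟶ X) (Y : ModuleCat.{0} R)
    (i : ℕ) (x : ((_root_.Ext R (ModuleCat R) i).obj (op X)).obj Y) :
    ModuleCat.derivedEquivExt X' Y i
        ((((_root_.Ext R (ModuleCat R) i).map g.op).app Y).hom x) =
      (Ext.mk₀ g).comp (ModuleCat.derivedEquivExt X Y i x) (zero_add i) :=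
  ProjectiveResolution.derivedEquivExt_map _ _ g i Y x

theorem localCohomology.exists_map_eq_zero (I : Ideal R) (Y : ModuleCat.{0} R) (i n : ℕ)
    (x : (((diagram (idealPowersDiagram I) i).obj (op (op n))).obj Y))
    (hx : ((colimit.ι (diagram (idealPowersDiagram I) i) (op (op n))).app Y).hom x = 0) :
    ∃ (m : ℕ) (h : n ≤ m),
      (((diagram (idealPowersDiagram I) i).map (homOfLE h).op.op).app Y).hom x = 0 := by
  obtain ⟨k, f, g, hfg⟩ := Concrete.isColimit_exists_of_rep_eq _
    (isColimitOfPreserves ((evaluation (ModuleCat.{0} R) (ModuleCat.{0} R)).obj Y)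
      (colimit.isColimit (diagram (idealPowersDiagram I) i)))
    (i := op (op n)) (j := op (op n)) x 0 (hx.trans (map_zero _).symm)
  exact ⟨k.unop.unop, f.unop.unop.le, hfg.trans (map_zero _)⟩

theorem localCohomology.exists_smul_mk₀_comp_eq_zero {I : Ideal R} {Y : ModuleCat.{0} R} {s : ℕ}
    {q : PrimeSpectrum R} (hq : q ∉ Module.support R ((localCohomology I s).obj Y)) (n : ℕ)
    (x : Abelian.Ext (ModuleCat.of R (R ⧸ I ^ n)) Y s) :
    ∃ u ∉ q.asIdeal, ∃ (m : ℕ) (h : n ≤ m),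
      (Ext.mk₀ (ModuleCat.ofHom (Submodule.factor (Ideal.pow_le_pow_right h)))).comp (u • x)
        (zero_add s) = 0 := by
  obtain ⟨y, rfl⟩ := (ModuleCat.derivedEquivExt (ModuleCat.of R (R ⧸ I ^ n)) Y s).surjective x
  obtain ⟨u, hu, hy⟩ := Module.notMem_support_iff'.1 hq
    (((colimit.ι (diagram (idealPowersDiagram I) s) (op (op n))).app Y).hom y)
  obtain ⟨m, h, hm⟩ := localCohomology.exists_map_eq_zero I Y s n (u • y)
    ((map_smul _ u y).trans hy)
  refine ⟨u, hu, m, h, ?_⟩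
  rw [← map_smul]
  refine (ModuleCat.derivedEquivExt_map (ModuleCat.ofHom (Submodule.factor
    (Ideal.pow_le_pow_right h))) Y s (u • y)).symm.trans ?_
  exact congr(ModuleCat.derivedEquivExt _ Y s $hm).trans (map_zero _)

end LC
section Torsion
universe u

open Abelian

variable {R : Type u} [CommRing R] {q : PrimeSpectrum R}

/-- The long exact sequence, up to elements which vanish locally at `q`. -/
theorem CategoryTheory.ShortComplex.ShortExact.exists_smul_eq_zero_of_mk₀_comp
    {S : ShortComplex (ModuleCat.{u} R)} (hS : S.ShortExact) {Y : ModuleCat.{u} R} {s : ℕ}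
    (h : ∀ i < s, q ∉ Module.support R (Ext S.X₁ Y i)) (x : Ext S.X₃ Y s)
    (hx : (Ext.mk₀ S.g).comp x (zero_add s) = 0) : ∃ v ∉ q.asIdeal, v • x = 0 := by
  cases s with
  | zero =>
    have := hS.epi_g
    refine ⟨1, q.asIdeal.primeCompl.one_mem, ?_⟩
    rw [one_smul]
    exact Ext.precomp_mk₀_injective_of_epi Y S.g (hx.trans (map_zero _).symm)
  | succ s =>
    obtain ⟨y, rfl⟩ := Ext.contravariant_sequence_exact₃ hS Y x hx (add_comm 1 s)
    obtain ⟨v, hv, hvy⟩ := Module.notMem_support_iff'.1 (h s s.lt_succ_self) y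
    exact ⟨v, hv, by rw [← Ext.comp_smul, hvy, Ext.comp_zero]⟩

theorem CategoryTheory.ShortComplex.ShortExact.exists_smul_eq_zero_of_smul_mk₀_comp
    {S : ShortComplex (ModuleCat.{u} R)} (hS : S.ShortExact) {Y : ModuleCat.{u} R} {s : ℕ}
    (h : ∀ i < s, q ∉ Module.support R (Ext S.X₁ Y i)) (x : Ext S.X₃ Y s)
    {v : R} (hv : v ∉ q.asIdeal) (hx : v • (Ext.mk₀ S.g).comp x (zero_add s) = 0) :
    ∃ v ∉ q.asIdeal, v • x = 0 := by
  rw [← Ext.comp_smul] at hx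
  obtain ⟨w, hw, hwx⟩ := hS.exists_smul_eq_zero_of_mk₀_comp h _ hx
  exact ⟨w * v, q.asIdeal.primeCompl.mul_mem hw hv, by rwa [mul_smul]⟩

theorem ModuleCat.subsingleton_ext_of_subsingleton (M Y : ModuleCat.{u} R) [Subsingleton M]
    (i : ℕ) : Subsingleton (Ext M Y i) := by
  refine subsingleton_of_forall_eq 0 fun x ↦ ?_
  rw [← Ext.mk₀_id_comp x, (ModuleCat.isZero_of_subsingleton M).eq_of_src (𝟙 M) 0, Ext.mk₀_zero,
    Ext.zero_comp]

theorem notMem_support_ext_of_surjective {A B : Type u} [AddCommGroup A] [Module R A]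
    [AddCommGroup B] [Module R B] (f : A →ₗ[R] B) (hf : Function.Surjective f)
    {Y : ModuleCat.{u} R} {s : ℕ}
    (hA : q ∉ Module.support R (Ext (ModuleCat.of R A) Y s))
    (hK : ∀ i < s, q ∉ Module.support R (Ext (ModuleCat.of R (LinearMap.ker f)) Y i)) :
    q ∉ Module.support R (Ext (ModuleCat.of R B) Y s) := by
  rw [Module.notMem_support_iff'] at hA ⊢
  intro x
  obtain ⟨v, hv, hvx⟩ := hA ((Ext.mk₀ (ModuleCat.ofHom f)).comp x (zero_add s))
  exact (LinearMap.shortExact_shortComplexKer hf).exists_smul_eq_zero_of_smul_mk₀_comp hK x hv hvx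

theorem notMem_support_ext_of_le_annihilator [IsNoetherianRing R] {I : Ideal R}
    {Y : ModuleCat.{u} R} {s : ℕ}
    (h : ∀ i < s, q ∉ Module.support R (Ext (ModuleCat.of R (R ⧸ I)) Y i))
    (M : Type u) [AddCommGroup M] [Module R M] [Module.Finite R M] {n : ℕ}
    (hM : I ^ n ≤ Module.annihilator R M) {i : ℕ} (hi : i < s) :
    q ∉ Module.support R (Ext (ModuleCat.of R M) Y i) := by
  induction i using Nat.strong_induction_on generalizing M n with
  | h i ih =>
  revert hM
  induction ‹Module.Finite R M› using IsNoetherianRing.induction_on_isQuotientEquivQuotientPrime R with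
  | subsingleton M =>
    have := ModuleCat.subsingleton_ext_of_subsingleton (ModuleCat.of R M) Y i
    simp [Module.support_eq_empty]
  | quotient M p e =>
    intro hM
    have hIp : I ≤ p.1 := by
      rw [e.annihilator_eq, Ideal.annihilator_quotient] at hM
      exact p.2.le_of_pow_le hM
    let f : (R ⧸ I) →ₗ[R] M := e.symm.toLinearMap ∘ₗ Submodule.factor hIp
    have hf : Function.Surjective f := e.symm.surjective.comp (Submodule.factor_surjective hIp)
    refine notMem_support_ext_of_surjective f hf (h i hi) fun l hl ↦
      ih l hl _ (n := 1) ?_ (hl.trans hi)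
    rw [pow_one]
    exact (Ideal.annihilator_quotient (I := I)).ge.trans
      ((LinearMap.ker f).subtype.annihilator_le_of_injective (LinearMap.ker f).injective_subtype)
  | exact M₁ M₂ M₃ f g hf hg hfg h₁ h₃ =>
    intro hM
    have h₁' := h₁ (hM.trans (f.annihilator_le_of_injective hf))
    have h₃' := h₃ (hM.trans (g.annihilator_le_of_surjective hg))
    have hS : (ShortComplex.mk (ModuleCat.ofHom f) (ModuleCat.ofHom g)
        (by ext x; exact hfg.apply_apply_eq_zero x)).ShortExact :=
      { exact := (ShortComplex.ShortExact.moduleCat_exact_iff_function_exact _).2 hfg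
        mono_f := (ModuleCat.mono_iff_injective _).2 hf
        epi_g := (ModuleCat.epi_iff_surjective _).2 hg }
    rw [Module.notMem_support_iff'] at h₁' h₃' ⊢
    intro x
    obtain ⟨v, hv, hvx⟩ := h₁' ((Ext.mk₀ (ModuleCat.ofHom f)).comp x (zero_add i))
    rw [← Ext.comp_smul] at hvx
    obtain ⟨y, hy⟩ := Ext.contravariant_sequence_exact₂ hS Y (v • x) hvx
    obtain ⟨w, hw, hwy⟩ := h₃' y
    refine ⟨w * v, q.asIdeal.primeCompl.mul_mem hw hv, ?_⟩
    rw [mul_smul, ← hy, ← Ext.comp_smul, hwy, Ext.comp_zero]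

/-- If `x` is killed by a prime `q` locally at `q`, and it is nonzero there,
then `q` is an associated prime. -/
theorem isAssociatedPrime_of_smul {M : Type*} [AddCommGroup M] [Module R M] [IsNoetherianRing R]
    {p : Ideal R} (hp : p.IsPrime) (y : M) (h : ∀ a ∈ p, ∃ v ∉ p, v • a • y = 0)
    (hy : ∀ v ∉ p, v • y ≠ 0) : IsAssociatedPrime p M := by
  classical
  obtain ⟨S, rfl⟩ := IsNoetherian.noetherian p
  choose! v hv hvy using h
  let w := ∏ a ∈ S, v a
  have hw : w ∉ Ideal.span (S : Set R) := by
    intro hw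
    obtain ⟨a, ha, haw⟩ := (Ideal.IsPrime.prod_mem_iff (hp := hp)).1 hw
    exact hv a (Ideal.subset_span ha) haw
  refine isAssociatedPrime_iff.2 ⟨hp, w • y, ?_⟩
  apply le_antisymm
  · refine Ideal.span_le.2 fun a ha ↦ ?_
    obtain ⟨c, hc⟩ : v a ∣ w := Finset.dvd_prod_of_mem v ha
    rw [SetLike.mem_coe, Submodule.mem_colon_singleton, Submodule.mem_bot, smul_comm, hc,
      mul_comm, mul_smul, hvy a (Ideal.subset_span ha), smul_zero]
  · intro a ha
    rw [Submodule.mem_colon_singleton, Submodule.mem_bot, smul_smul] at ha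
    by_contra hap
    exact hy _ (fun h ↦ (hp.mem_or_mem h).elim hap hw) ha

end Torsion

section Main
open Abelian

theorem smul_ext_eq_zero_of_mem_annihilator {R : Type*} [CommRing R] {M Y : ModuleCat R} {i : ℕ}
    {a : R} (ha : a ∈ Module.annihilator R M) (x : Ext M Y i) : a • x = 0 := by
  rw [← Ext.mk₀_id_comp x, ← Ext.smul_comp, ← Ext.mk₀_smul,
    show a • 𝟙 M = 0 by ext m; exact Module.mem_annihilator.1 ha m, Ext.mk₀_zero, Ext.zero_comp]

theorem IsAssociatedPrime.mem_support {R M : Type*} [CommRing R] [IsNoetherianRing R]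
    [AddCommGroup M] [Module R M] {p : PrimeSpectrum R} (h : IsAssociatedPrime p.asIdeal M) :
    p ∈ Module.support R M := by
  obtain ⟨-, x, hx⟩ := isAssociatedPrime_iff.1 h
  refine Module.mem_support_iff'.2 ⟨x, fun a ha hax ↦ ha ?_⟩
  rwa [hx, Submodule.mem_colon_singleton, Submodule.mem_bot]

theorem isAssociatedPrime_of_mem_support {R M : Type*} [CommRing R] [IsNoetherianRing R]
    [AddCommGroup M] [Module R M] [Module.Finite R M] {p : PrimeSpectrum R}
    (h : p ∈ Module.support R M) (hmin : ∀ q < p, q ∉ Module.support R M) :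
    IsAssociatedPrime p.asIdeal M := by
  refine Module.associatedPrimes.minimalPrimes_annihilator_subset_associatedPrimes R M
    ⟨⟨p.2, Module.annihilator_le_of_mem_support h⟩, fun q ⟨hq, hann⟩ hqp ↦ ?_⟩
  by_contra hpq
  refine hmin ⟨q, hq⟩ (lt_of_le_not_ge hqp hpq) ?_
  rwa [Module.support_eq_zeroLocus]

/-- In a Noetherian local ring the dimension of `R ⧸ p` is strictly decreasing in the prime `p`. -/
theorem ringKrullDim_quotient_lt_of_lt {R : Type*} [CommRing R] [IsNoetherianRing R] [IsLocalRing R]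
    {q p : PrimeSpectrum R} (h : q < p) :
    ringKrullDim (R ⧸ p.asIdeal) < ringKrullDim (R ⧸ q.asIdeal) := by
  obtain ⟨b, hbp, hbq⟩ := Set.exists_of_ssubset h
  have : IsLocalRing (R ⧸ p.asIdeal) :=
    .of_surjective' (Ideal.Quotient.mk p.asIdeal) Ideal.Quotient.mk_surjective
  have hle := ringKrullDim_succ_le_of_surjective (Ideal.Quotient.factor h.le)
    (Ideal.Quotient.factor_surjective h.le) (r := Ideal.Quotient.mk _ b)
    (mem_nonZeroDivisors_of_ne_zero (mt Ideal.Quotient.eq_zero_iff_mem.1 hbq))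
    (Ideal.Quotient.eq_zero_iff_mem.2 hbp)
  refine lt_of_lt_of_le ?_ hle
  have h1 : ringKrullDim (R ⧸ p.asIdeal) ≠ ⊥ := ringKrullDim_ne_bot
  have h2 : ringKrullDim (R ⧸ p.asIdeal) ≠ ⊤ := ringKrullDim_ne_top
  generalize ringKrullDim (R ⧸ p.asIdeal) = d at h1 h2
  lift d to ℕ∞ using h1
  lift d to ℕ using fun h ↦ h2 (congrArg _ h)
  exact_mod_cast d.lt_succ_self

theorem notMem_support_ext_of_localCohomology {R : Type} [CommRing R] [IsNoetherianRing R]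
    {I : Ideal R} {Y : ModuleCat.{0} R} {q : PrimeSpectrum R} {r : ℕ}
    (h : ∀ i < r, q ∉ Module.support R ((localCohomology I i).obj Y)) {s : ℕ} (hs : s < r) :
    q ∉ Module.support R (Ext (ModuleCat.of R (R ⧸ I)) Y s) := by
  induction s using Nat.strong_induction_on with
  | h s ih =>
  suffices q ∉ Module.support R (Ext (ModuleCat.of R (R ⧸ I ^ 1)) Y s) by rwa [pow_one] at this
  refine Module.notMem_support_iff'.2 fun x ↦ ?_
  obtain ⟨u, hu, m, hm, hx⟩ := localCohomology.exists_smul_mk₀_comp_eq_zero (h s hs) 1 x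
  let f : (R ⧸ I ^ m) →ₗ[R] (R ⧸ I ^ 1) := Submodule.factor (Ideal.pow_le_pow_right hm)
  have hf : Function.Surjective f := Submodule.factor_surjective _
  refine (LinearMap.shortExact_shortComplexKer hf).exists_smul_eq_zero_of_smul_mk₀_comp
    (fun i hi ↦ ?_) x hu (by rwa [← Ext.comp_smul])
  refine notMem_support_ext_of_le_annihilator (s := s) (fun l hl ↦ ih l hl (hl.trans hs))
    (LinearMap.ker f) (n := m) ?_ hi
  exact (Ideal.annihilator_quotient (I := I ^ m)).ge.trans
    ((LinearMap.ker f).subtype.annihilator_le_of_injective (LinearMap.ker f).injective_subtype)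

theorem isAssociatedPrime_ext_of_pow {R : Type} [CommRing R] [IsNoetherianRing R]
    {I : Ideal R} {Y : ModuleCat.{0} R} {p : PrimeSpectrum R} {s t : ℕ} (ht : t ≠ 0)
    (hI : I ≤ p.asIdeal)
    (h : ∀ i < s, p ∉ Module.support R (Ext (ModuleCat.of R (R ⧸ I)) Y i))
    (hp : IsAssociatedPrime p.asIdeal (Ext (ModuleCat.of R (R ⧸ I ^ t)) Y s)) :
    IsAssociatedPrime p.asIdeal (Ext (ModuleCat.of R (R ⧸ I)) Y s) := by
  obtain ⟨-, x, hx⟩ := isAssociatedPrime_iff.1 hp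
  replace hx (a : R) : a ∈ p.asIdeal ↔ a • x = 0 := by
    rw [hx, Submodule.mem_colon_singleton, Submodule.mem_bot]
  let f : (R ⧸ I ^ t) →ₗ[R] (R ⧸ I) := Submodule.factor (Ideal.pow_le_self ht)
  have hf : Function.Surjective f := Submodule.factor_surjective _
  have hfS := LinearMap.shortExact_shortComplexKer hf
  have hker : I ^ t ≤ Module.annihilator R (LinearMap.ker f) :=
    (Ideal.annihilator_quotient (I := I ^ t)).ge.trans
      ((LinearMap.ker f).subtype.annihilator_le_of_injective (LinearMap.ker f).injective_subtype)
  obtain ⟨n, a, ha⟩ := Submodule.fg_iff_exists_fin_generating_family.1 (IsNoetherian.noetherian I)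
  have haI (i : Fin n) : a i ∈ I := ha ▸ Submodule.subset_span (Set.mem_range_self i)
  let g₀ : (Fin n → R ⧸ I ^ t) →ₗ[R] R ⧸ I ^ t := ∑ i, a i • LinearMap.proj i
  have hg₀ (v) : f (g₀ v) = 0 := by
    simp only [g₀, LinearMap.sum_apply, LinearMap.smul_apply, map_sum, map_smul]
    refine Finset.sum_eq_zero fun i _ ↦ ?_
    exact Module.mem_annihilator.1 ((Ideal.annihilator_quotient (I := I)).ge (haI i)) _
  let g : (Fin n → R ⧸ I ^ t) →ₗ[R] LinearMap.ker f := g₀.codRestrict _ hg₀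
  have hg_apply (v) : (g v : R ⧸ I ^ t) = ∑ i, a i • v i := by
    refine (LinearMap.sum_apply _ _ v).trans ?_
    rfl
  have hg : Function.Surjective g := by
    rintro ⟨y, hy⟩
    obtain ⟨b, rfl⟩ := Ideal.Quotient.mk_surjective y
    have hb : b ∈ I := Ideal.Quotient.eq_zero_iff_mem.1 hy
    rw [← ha] at hb
    obtain ⟨c, rfl⟩ := (Submodule.mem_span_range_iff_exists_fun R).1 hb
    refine ⟨fun i ↦ Ideal.Quotient.mk _ (c i), Subtype.ext ?_⟩
    refine (hg_apply _).trans (Eq.trans ?_ (map_sum (Ideal.Quotient.mk (I ^ t)) _ _).symm)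
    exact Finset.sum_congr rfl fun i _ ↦
      (map_mul (Ideal.Quotient.mk _) (a i) (c i)).symm.trans (by rw [mul_comm, smul_eq_mul])
  have hgS := LinearMap.shortExact_shortComplexKer hg
  have hgx : (Ext.mk₀ (ModuleCat.ofHom g)).comp
      ((Ext.mk₀ (ModuleCat.ofHom (LinearMap.ker f).subtype)).comp x (zero_add s))
        (zero_add s) = 0 := by
    have : ModuleCat.ofHom g ≫ ModuleCat.ofHom (LinearMap.ker f).subtype =
        ∑ i, a i • ModuleCat.ofHom (LinearMap.proj i) := by
      refine ModuleCat.hom_ext (LinearMap.ext fun v ↦ (hg_apply v).trans ?_)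
      rw [ModuleCat.hom_sum, LinearMap.sum_apply]
      rfl
    rw [Ext.mk₀_comp_mk₀_assoc, this, Ext.mk₀_sum, Ext.sum_comp]
    refine Finset.sum_eq_zero fun i _ ↦ ?_
    rw [Ext.mk₀_smul, Ext.smul_comp, ← Ext.comp_smul, (hx _).1 (hI (haI i)), Ext.comp_zero]
  have hann : I ^ t ≤ Module.annihilator R (Fin n → R ⧸ I ^ t) := fun b hb ↦
    Module.mem_annihilator.2 fun v ↦ funext fun i ↦
      Module.mem_annihilator.1 ((Ideal.annihilator_quotient (I := I ^ t)).ge hb) (v i)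
  obtain ⟨u, hu, hux⟩ := hgS.exists_smul_eq_zero_of_mk₀_comp (q := p) (fun i hi ↦
    notMem_support_ext_of_le_annihilator h (LinearMap.ker g) (n := t)
      (hann.trans
        ((LinearMap.ker g).subtype.annihilator_le_of_injective
          (LinearMap.ker g).injective_subtype)) hi) _ hgx
  rw [← Ext.comp_smul] at hux
  obtain ⟨y, hy⟩ := Ext.contravariant_sequence_exact₂ hfS Y (u • x) hux
  refine isAssociatedPrime_of_smul p.2 y (fun b hb ↦ ?_) fun v hv hvy ↦ ?_
  · refine hfS.exists_smul_eq_zero_of_mk₀_comp (fun i hi ↦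
      notMem_support_ext_of_le_annihilator h (LinearMap.ker f) hker hi) _ ?_
    rw [Ext.comp_smul, hy, smul_comm, (hx b).1 hb, smul_zero]
  · have := congr(v • $hy)
    rw [← Ext.comp_smul, hvy, Ext.comp_zero, ← mul_smul] at this
    exact (p.2.mem_or_mem ((hx _).2 this.symm)).elim hv hu

end Main

/-- Brodmann–Nhan type result: if `dim Supp H^i_I(N) ≤ k` for all `i < r`, then for every
`j ≤ r` and every `t > 0`, `Ass_R(Ext^j_R(R/I^t,N))_{≥k}` is contained in the finite set
`⋃_{i≤j} Ass_R(Ext^i_R(R/I,N))`. -/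
theorem ass_ext_power_subset (R : Type) [CommRing R] [IsNoetherianRing R] [IsLocalRing R]
    (I : Ideal R) (N : Type) [AddCommGroup N] [Module R N] [Module.Finite R N]
    (k : ℤ) (hk : -1 ≤ k) (r : ℕ)
    (hsupp : ∀ i < r, ∀ p ∈ Module.support R
        ((localCohomology I i).obj (ModuleCat.of R N)),
      ringKrullDim (R ⧸ p.asIdeal) ≤ zdim k)
    (j : ℕ) (hj : j ≤ r) (t : ℕ) (ht : 0 < t) :
    (⋃ i ≤ j, associatedPrimes R
        (((Ext R (ModuleCat R) i).obj (op (ModuleCat.of R (R ⧸ I)))).obj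
          (ModuleCat.of R N))).Finite
    ∧ associatedPrimes R
        (((Ext R (ModuleCat R) j).obj (op (ModuleCat.of R (R ⧸ I ^ t)))).obj (ModuleCat.of R N))
        ∩ dimGE R k
      ⊆ ⋃ i ≤ j, associatedPrimes R
          (((Ext R (ModuleCat R) i).obj (op (ModuleCat.of R (R ⧸ I)))).obj
            (ModuleCat.of R N)) := by
  have key (i : ℕ) (J : Ideal R) := LinearEquiv.AssociatedPrimes.eq
    (ModuleCat.derivedEquivExt (ModuleCat.of R (R ⧸ J)) (ModuleCat.of R N) i)
  simp only [key]
  refine ⟨(Set.finite_Iic j).biUnion fun i _ ↦ associatedPrimes.finite R _, ?_⟩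
  rintro p₀ ⟨hp, hdim⟩
  let p : PrimeSpectrum R := ⟨p₀, hp.isPrime⟩
  have hIp : I ≤ p.asIdeal := by
    refine p.2.le_of_pow_le (n := t) fun a ha ↦ ?_
    obtain ⟨-, x, hx⟩ := isAssociatedPrime_iff.1 hp
    rw [show p.asIdeal = _ from hx, Submodule.mem_colon_singleton, Submodule.mem_bot]
    exact smul_ext_eq_zero_of_mem_annihilator ((Ideal.annihilator_quotient (I := I ^ t)).ge ha) x
  have hex : ∃ s, s ≤ j ∧ p ∈ Module.support R
      (Abelian.Ext (ModuleCat.of R (R ⧸ I)) (ModuleCat.of R N) s) := by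
    by_contra! hne
    exact notMem_support_ext_of_le_annihilator (s := j + 1)
      (fun i hi ↦ hne i (Nat.le_of_lt_succ hi)) (R ⧸ I ^ t)
      (Ideal.annihilator_quotient (I := I ^ t)).ge (Nat.lt_succ_self j)
      (IsAssociatedPrime.mem_support (p := p) hp)
  classical
  obtain ⟨hsj, hs⟩ := Nat.find_spec hex
  have hmin : ∀ i < Nat.find hex, p ∉ Module.support R
      (Abelian.Ext (ModuleCat.of R (R ⧸ I)) (ModuleCat.of R N) i) :=
    fun i hi h ↦ Nat.find_min hex hi ⟨hi.le.trans hsj, h⟩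
  generalize Nat.find hex = s at hsj hs hmin
  refine Set.mem_biUnion (x := s) hsj ?_
  obtain hsr | hrs := lt_or_ge s r
  · refine isAssociatedPrime_of_mem_support (p := p) hs fun q hqp ↦ ?_
    refine notMem_support_ext_of_localCohomology (I := I) (Y := ModuleCat.of R N) (r := r)
      (fun i hi hq ↦ ?_) hsr
    have hle : ringKrullDim (R ⧸ q.asIdeal) ≤ ringKrullDim (R ⧸ p.asIdeal) :=
      (hsupp i hi q hq).trans hdim
    exact hle.not_gt (ringKrullDim_quotient_lt_of_lt hqp)
  · obtain rfl : s = j := hsj.antisymm (hj.trans hrs)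
    exact isAssociatedPrime_ext_of_pow (p := p) ht.ne' hIp hmin hp
end
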